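/- A college c with capacity q(c) = 1 cannot beneficially manipulate the college-optimal stable mechanism via misrepresenting its preferences when all other agents report truthfully: for every complete strict misreport >' over S, the student matched to c under the manipulated college-optimal stable matching is not strictly preferred by c's true order to the student matched to c under the truthful college-optimal stable matching. -/

import Mathlib

/-- A college admissions market: capacities `q` (each at least 1) and, for every
student and every college, a strict complete preference list, modelled as a
`LinearOrder` in which *greater* means *more preferred*. -/
structure Market (S C : Type*) [Fintype S] [Fintype C] where
  q : C → ℕ
  q_pos : ∀ c, 1 ≤ q c
  sPref : S → LinearOrder C
  cPref : C → LinearOrder S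

variable {S C : Type*} [Fintype S] [Fintype C]

/-- Student `s` strictly prefers college `c` to college `c'`. -/
def Market.sprefers (M : Market S C) (s : S) (c c' : C) : Prop :=
  (M.sPref s).lt c' c

/-- College `c` strictly prefers student `s` to student `s'`. -/
def Market.cprefers (M : Market S C) (c : C) (s s' : S) : Prop :=
  (M.cPref c).lt s' s

/-- A matching: each college gets a set of students within its capacity, and the
sets of distinct colleges are disjoint (so each student has at most one college). -/
structure Matching (M : Market S C) where
  assign : C → Finset S
  card_le : ∀ c, (assign c).card ≤ M.q c
  disjoint : ∀ c c', c ≠ c' → Disjoint (assign c) (assign c')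

/-- `(s, c)` is a blocking pair: `s` is unmatched or prefers `c` to his current
college, and `c` has a free slot or prefers `s` to one of its current students. -/
def Blocks (M : Market S C) (μ : Matching M) (s : S) (c : C) : Prop :=
  (∀ c', s ∈ μ.assign c' → M.sprefers s c c') ∧
  ((μ.assign c).card < M.q c ∨ ∃ s' ∈ μ.assign c, M.cprefers c s s')

/-- A matching is stable if it admits no blocking pair. -/
def Stable (M : Market S C) (μ : Matching M) : Prop :=
  ∀ s c, ¬ Blocks M μ s c

/-- Student `s` weakly prefers his assignment under `μ` to his assignment under `ν`:
either the assignments coincide, or `s` is matched under `μ` to a college that he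
strictly prefers to his situation under `ν` (being matched beats being unmatched). -/
def SWeakPref (M : Market S C) (μ ν : Matching M) (s : S) : Prop :=
  (∀ c, s ∈ μ.assign c ↔ s ∈ ν.assign c) ∨
  ∃ c, s ∈ μ.assign c ∧
    ((∀ c', s ∉ ν.assign c') ∨ ∃ c', s ∈ ν.assign c' ∧ M.sprefers s c c')

/-- The student-optimal stable matching. -/
def StudentOptimal (M : Market S C) (μ : Matching M) : Prop :=
  Stable M μ ∧ ∀ ν : Matching M, Stable M ν → ∀ s, SWeakPref M μ ν s

/-- `X` (weakly) responsively dominates `Y` w.r.t. college `c`'s preferences: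
there is an injection `g : Y → X` with `g s = s` or `g s >_c s` for all `s ∈ Y`. -/
def RespDominates (M : Market S C) (c : C) (X Y : Finset S) : Prop :=
  ∃ g : S → S, Set.InjOn g ↑Y ∧ (∀ s ∈ Y, g s ∈ X) ∧
    ∀ s ∈ Y, g s = s ∨ M.cprefers c (g s) s

/-- Strict responsive domination. -/
def StrictRespDominates (M : Market S C) (c : C) (X Y : Finset S) : Prop :=
  X ≠ Y ∧ RespDominates M c X Y

/-- The college-optimal stable matching. -/
def CollegeOptimal (M : Market S C) (μ : Matching M) : Prop :=
  Stable M μ ∧ ∀ ν : Matching M, Stable M ν → ∀ c, RespDominates M c (μ.assign c) (ν.assign c)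

/-- The market in which college `c` reports the list `P` instead of its true list,
while everything else is unchanged. -/
def replaceCPref [DecidableEq C] (M : Market S C) (c : C) (P : LinearOrder S) :
    Market S C :=
  { M with cPref := Function.update M.cPref c P }

/-- The market in which student `s` reports the list `P` instead of his true list,
while everything else is unchanged. -/
def replaceSPref [DecidableEq S] (M : Market S C) (s : S) (P : LinearOrder C) :
    Market S C :=
  { M with sPref := Function.update M.sPref s P }

/-- Preferences of a student over the copies of the colleges in the associated
one-to-one market: copies of colleges are compared according to the student's order
over colleges, and within a block of copies smaller index is better. -/
def assocSPref (M : Market S C) (s : S) : LinearOrder ((c : C) × Fin (M.q c)) :=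
  letI := M.sPref s
  LinearOrder.lift' (fun x => toLex ((x.1 : C), (M.q x.1 - (x.2 : ℕ)))) (by
    rintro ⟨c, i⟩ ⟨c', j⟩ h
    have h' : ((c : C), M.q c - (i : ℕ)) = (c', M.q c' - (j : ℕ)) := toLex.injective h
    have h1 : c = c' := congrArg Prod.fst h'
    subst h1
    have h2 : M.q c - (i : ℕ) = M.q c - (j : ℕ) := congrArg Prod.snd h'
    have hi := i.isLt
    have hj := j.isLt
    have : (i : ℕ) = (j : ℕ) := by omega
    exact congrArg (Sigma.mk c) (Fin.ext this))

/-- The associated one-to-one market: college `c` is replaced by `q c` copies,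
each of capacity one and with `c`'s preferences over students; students' preferences
over copies are induced blockwise from their preferences over colleges. -/
def assocMarket (M : Market S C) : Market S ((c : C) × Fin (M.q c)) :=
  { q := fun _ => 1
    q_pos := fun _ => le_refl 1
    sPref := assocSPref M
    cPref := fun x => M.cPref x.1 }

/-- The `q` best elements of a finite set `A`: those with fewer than `q` better ones. -/
noncomputable def topElements {α : Type*} (r : LinearOrder α) (q : ℕ) (A : Finset α) : Finset α :=
  open Classical in {a ∈ A | {b ∈ A | r.lt a b}.card < q}

theorem card_topElements_le {α : Type*} (r : LinearOrder α) (q : ℕ) (A : Finset α) :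
    (topElements r q A).card ≤ q := by
  classical
  rcases (topElements r q A).eq_empty_or_nonempty with he | hne
  · simp [he]
  obtain ⟨a, ha, hmin⟩ := (topElements r q A).exists_min_image id hne
  have hsub : topElements r q A ⊆ insert a {b ∈ A | r.lt a b} := by
    intro b hb
    rcases eq_or_lt_of_le (hmin b hb) with h | h
    · exact Finset.mem_insert.2 (Or.inl h.symm)
    · exact Finset.mem_insert.2
        (Or.inr (Finset.mem_filter.2 ⟨(Finset.mem_filter.1 hb).1, h⟩))
  have hcard : {b ∈ A | r.lt a b}.card < q := by
    have := (Finset.mem_filter.1 ha).2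
    convert this
  have := (Finset.card_le_card hsub).trans (Finset.card_insert_le _ _)
  omega

theorem le_card_topElements {α : Type*} (r : LinearOrder α) (q : ℕ) {A : Finset α} {a : α}
    (ha : a ∈ A) (hna : a ∉ topElements r q A) : q ≤ (topElements r q A).card := by
  classical
  obtain ⟨b, hb, hmax⟩ := (A \ topElements r q A).exists_max_image id
    ⟨a, Finset.mem_sdiff.2 ⟨ha, hna⟩⟩
  obtain ⟨hbA, hbt⟩ := Finset.mem_sdiff.1 hb
  have hq : q ≤ {x ∈ A | r.lt b x}.card := by
    by_contra hlt
    refine hbt (Finset.mem_filter.2 ⟨hbA, ?_⟩)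
    convert not_le.1 hlt
  refine hq.trans (Finset.card_le_card fun x hx => ?_)
  obtain ⟨hxA, hbx⟩ := Finset.mem_filter.1 hx
  by_contra hxt
  exact absurd (hmax x (Finset.mem_sdiff.2 ⟨hxA, hxt⟩)) (not_le.2 hbx)

theorem lt_of_mem_topElements {α : Type*} (r : LinearOrder α) (q : ℕ) {A : Finset α} {a b : α}
    (ha : a ∈ A) (hna : a ∉ topElements r q A) (hb : b ∈ topElements r q A) : r.lt a b := by
  classical
  by_contra hab
  have hba : b ≤ a := not_lt.1 hab
  refine hna (Finset.mem_filter.2 ⟨ha, ?_⟩)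
  refine lt_of_le_of_lt (Finset.card_le_card fun x hx => ?_) (Finset.mem_filter.1 hb).2
  obtain ⟨hxA, hax⟩ := Finset.mem_filter.1 hx
  exact Finset.mem_filter.2 ⟨hxA, lt_of_le_of_lt hba hax⟩

/-- The matching `μ` is stable in the market where college `d` finds only the students
in `A d` acceptable. -/
def StableOn (M : Market S C) (A : C → Set S)
    (μ : Matching M) : Prop :=
  (∀ d, ∀ s ∈ μ.assign d, s ∈ A d) ∧ ∀ d, ∀ s ∈ A d, ¬ Blocks M μ s d

/-- The acceptable students who apply to `d` at some point, when `R` is the set of rejections. -/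
noncomputable def applicants (M : Market S C)
    (A : C → Set S) (R : Set (S × C)) (d : C) : Finset S :=
  open Classical in {s | s ∈ A d ∧ ∀ d', M.sprefers s d' d → (s, d') ∈ R}

theorem mem_applicants {M : Market S C}
    {A : C → Set S} {R : Set (S × C)} {d : C} {s : S} :
    s ∈ applicants M A R d ↔ s ∈ A d ∧ ∀ d', M.sprefers s d' d → (s, d') ∈ R := by
  simp [applicants]

/-- One round of student-proposing deferred acceptance, as a monotone map on the set of
rejections. -/
def rejectionStep (M : Market S C)
    (A : C → Set S) : Set (S × C) →o Set (S × C) where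
  toFun R := open Classical in {p | p.1 ∈ A p.2 →
    M.q p.2 ≤ {t ∈ applicants M A R p.2 | M.cprefers p.2 t p.1}.card}
  monotone' := by
    classical
    intro R R' hR p hp hA
    refine (hp hA).trans (Finset.card_le_card fun t ht => ?_)
    obtain ⟨ht, htp⟩ := Finset.mem_filter.1 ht
    obtain ⟨htA, htR⟩ := mem_applicants.1 ht
    exact Finset.mem_filter.2 ⟨mem_applicants.2 ⟨htA, fun d' h => hR (htR d' h)⟩, htp⟩

theorem exists_stableOn (M : Market S C)
    (A : C → Set S) : ∃ μ : Matching M, StableOn M A μ := by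
  classical
  set R : Set (S × C) := (rejectionStep M A).lfp
  have hfix : rejectionStep M A R = R := (rejectionStep M A).map_lfp
  have hmem (s d) (hs : s ∈ applicants M A R d) :
      s ∈ topElements (M.cPref d) (M.q d) (applicants M A R d) ↔ (s, d) ∉ R := by
    have hA := (mem_applicants.1 hs).1
    have hR : (s, d) ∈ R ↔
        M.q d ≤ {t ∈ applicants M A R d | M.cprefers d t s}.card := by
      conv_lhs => rw [← hfix]
      change (s ∈ A d → _) ↔ _
      simp only [hA, true_imp_iff]
    rw [hR, not_le, topElements, Finset.mem_filter, and_iff_right hs]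
    unfold Market.cprefers
    congr!
  have happ {s d} (h : s ∈ topElements (M.cPref d) (M.q d) (applicants M A R d)) :
      s ∈ applicants M A R d := (Finset.mem_filter.1 h).1
  have hunacc {s d} (h : (s, d) ∉ R) : s ∈ A d := by
    by_contra hA
    refine h ?_
    rw [← hfix]
    exact fun hA' => absurd hA' hA
  have hdisj {s d d'} (h : s ∈ topElements (M.cPref d) (M.q d) (applicants M A R d))
      (h' : s ∈ topElements (M.cPref d') (M.q d') (applicants M A R d')) :
      ¬ M.sprefers s d' d := fun hlt =>
    (hmem s d' (happ h')).1 h' ((mem_applicants.1 (happ h)).2 d' hlt)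
  refine ⟨⟨fun d => topElements (M.cPref d) (M.q d) (applicants M A R d),
    fun d => card_topElements_le _ _ _, fun d d' hne => ?_⟩,
    fun d s hs => (mem_applicants.1 (happ hs)).1, ?_⟩
  · refine Finset.disjoint_left.2 fun s hs hs' => ?_
    let _ := M.sPref s
    rcases lt_or_gt_of_ne hne with h | h
    · exact hdisj hs hs' h
    · exact hdisj hs' hs h
  · rintro d s hA ⟨hpref, hcap⟩
    have hbetter (d') (hd' : M.sprefers s d' d) : (s, d') ∈ R := by
      by_contra hn
      let _ := M.sPref s
      obtain ⟨e, he, hmax⟩ := Finset.exists_max_image {x : C | (s, x) ∉ R} id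
        ⟨d', by simpa using hn⟩
      have heR : (s, e) ∉ R := by simpa using he
      have hes : s ∈ applicants M A R e := by
        refine mem_applicants.2 ⟨hunacc heR, fun x hx => ?_⟩
        by_contra hxR
        exact absurd (hmax x (by simpa using hxR)) (not_le.2 hx)
      have hde : d' ≤ e := hmax d' (by simpa using hn)
      have hed : e < d := hpref e ((hmem s e hes).2 heR)
      exact absurd (hde.trans_lt hed) (not_lt.2 (le_of_lt hd'))
    have hs : s ∈ applicants M A R d := mem_applicants.2 ⟨hA, hbetter⟩
    by_cases hst : s ∈ topElements (M.cPref d) (M.q d) (applicants M A R d)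
    · let _ := M.sPref s
      exact lt_irrefl d (hpref d hst)
    rcases hcap with hlt | ⟨t, ht, hlt⟩
    · exact absurd hlt (not_lt.2 (le_card_topElements _ _ hs hst))
    · let _ := M.cPref d
      exact lt_asymm (lt_of_mem_topElements _ _ hs hst ht) hlt

/-- Student `s` is matched under `μ` and strictly prefers `μ` to `ν`. -/
def StrictlyPrefersMatching (M : Market S C)
    (μ ν : Matching M) (s : S) : Prop :=
  ∃ d, s ∈ μ.assign d ∧ ∀ d', s ∈ ν.assign d' → M.sprefers s d d'

theorem exists_assigned_of_not_blocks {M : Market S C}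
    {μ : Matching M} {s : S} {d : C} (hb : ¬ Blocks M μ s d) (hs : s ∉ μ.assign d)
    (hcap : (μ.assign d).card < M.q d ∨ ∃ t ∈ μ.assign d, M.cprefers d s t) :
    ∃ e, s ∈ μ.assign e ∧ M.sprefers s e d := by
  by_contra! hn
  refine hb ⟨fun e he => ?_, hcap⟩
  let _ := M.sPref s
  exact lt_of_le_of_ne (not_lt.1 (hn e he)) (fun h => hs (h ▸ he))

theorem Matching.eq_of_mem {M : Market S C}
    (μ : Matching M) {s : S} {d e : C} (hd : s ∈ μ.assign d) (he : s ∈ μ.assign e) : d = e := by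
  by_contra hne
  exact Finset.disjoint_left.1 (μ.disjoint d e hne) hd he

theorem strictlyPrefersMatching_of_lt {M : Market S C}
    {μ ν : Matching M} {s : S} {d : C} (hd : s ∈ ν.assign d)
    (h : ∃ e, s ∈ μ.assign e ∧ M.sprefers s e d) : StrictlyPrefersMatching M μ ν s := by
  obtain ⟨e, he, hlt⟩ := h
  exact ⟨e, he, fun d' hd' => ν.eq_of_mem hd hd' ▸ hlt⟩

open Classical in
theorem StableOn.card_gainers_le {M : Market S C}
    {A : C → Set S} {μ ν : Matching M} (hμ : StableOn M A μ) (hν : StableOn M A ν) (d : C) :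
    {s ∈ μ.assign d | StrictlyPrefersMatching M μ ν s}.card ≤
      {s ∈ ν.assign d | StrictlyPrefersMatching M μ ν s}.card := by
  rcases Finset.eq_empty_or_nonempty {s ∈ μ.assign d | StrictlyPrefersMatching M μ ν s}
    with he | ⟨s, hs⟩
  · simp [he]
  obtain ⟨hsd, e, hse, hsν⟩ := Finset.mem_filter.1 hs
  obtain rfl := μ.eq_of_mem hsd hse
  have hnot : ¬ ((ν.assign d).card < M.q d ∨ ∃ t ∈ ν.assign d, M.cprefers d s t) :=
    fun h => hν.2 d s (hμ.1 d s hsd) ⟨hsν, h⟩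
  have hfull : M.q d ≤ (ν.assign d).card := not_lt.1 fun h => hnot (Or.inl h)
  have hirr {t} : ¬ M.sprefers t d d := by
    let _ := M.sPref t
    exact lt_irrefl d
  have hleft : {s ∈ μ.assign d | StrictlyPrefersMatching M μ ν s} ⊆
      μ.assign d \ ν.assign d := by
    intro t ht
    obtain ⟨htd, f, htf, htν⟩ := Finset.mem_filter.1 ht
    obtain rfl := μ.eq_of_mem htd htf
    exact Finset.mem_sdiff.2 ⟨htd, fun h => hirr (htν d h)⟩
  have hright : ν.assign d \ μ.assign d ⊆
      {s ∈ ν.assign d | StrictlyPrefersMatching M μ ν s} := by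
    intro t ht
    obtain ⟨htν, htμ⟩ := Finset.mem_sdiff.1 ht
    refine Finset.mem_filter.2 ⟨htν, strictlyPrefersMatching_of_lt htν ?_⟩
    refine exists_assigned_of_not_blocks (hμ.2 d t (hν.1 d t htν)) htμ (Or.inr ⟨s, hsd, ?_⟩)
    let _ := M.cPref d
    exact lt_of_le_of_ne (not_lt.1 fun h => hnot (Or.inr ⟨t, htν, h⟩))
      (fun h => htμ (h ▸ hsd))
  have h1 := Finset.card_le_card hleft
  have h2 := Finset.card_le_card hright
  have h3 := Finset.card_sdiff_add_card_inter (μ.assign d) (ν.assign d)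
  have h4 := Finset.card_sdiff_add_card_inter (ν.assign d) (μ.assign d)
  rw [Finset.inter_comm] at h4
  have h5 := μ.card_le d
  omega

/-- A college left empty by one stable matching is left empty by every stable matching. -/
theorem StableOn.assign_eq_empty {M : Market S C}
    {A : C → Set S} {μ ν : Matching M} (hμ : StableOn M A μ) (hν : StableOn M A ν) {c : C}
    (hc : μ.assign c = ∅) : ν.assign c = ∅ := by
  classical
  by_contra hne
  obtain ⟨s, hs⟩ := Finset.nonempty_iff_ne_empty.2 hne
  have hsgain : StrictlyPrefersMatching M μ ν s := by
    refine strictlyPrefersMatching_of_lt hs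
      (exists_assigned_of_not_blocks (hμ.2 c s (hν.1 c s hs)) (by simp [hc]) (Or.inl ?_))
    have := M.q_pos c
    rw [hc, Finset.card_empty]
    omega
  have hlt : ∑ d, {s ∈ μ.assign d | StrictlyPrefersMatching M μ ν s}.card <
      ∑ d, {s ∈ ν.assign d | StrictlyPrefersMatching M μ ν s}.card := by
    refine Finset.sum_lt_sum (fun d _ => hμ.card_gainers_le hν d) ⟨c, Finset.mem_univ c, ?_⟩
    rw [hc, Finset.filter_empty, Finset.card_empty]
    exact Finset.card_pos.2 ⟨s, Finset.mem_filter.2 ⟨hs, hsgain⟩⟩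
  have hbiUnion (ρ : Matching M) :
      ∑ d, {s ∈ ρ.assign d | StrictlyPrefersMatching M μ ν s}.card =
        (Finset.univ.biUnion fun d =>
          {s ∈ ρ.assign d | StrictlyPrefersMatching M μ ν s}).card :=
    (Finset.card_biUnion fun d _ e _ hde =>
      (ρ.disjoint d e hde).mono (Finset.filter_subset _ _) (Finset.filter_subset _ _)).symm
  rw [hbiUnion, hbiUnion] at hlt
  refine absurd hlt (not_lt.2 (Finset.card_le_card fun t ht => ?_))
  obtain ⟨d, -, htd⟩ := Finset.mem_biUnion.1 ht
  obtain ⟨e, hte, -⟩ := (Finset.mem_filter.1 htd).2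
  exact Finset.mem_biUnion.2 ⟨e, Finset.mem_univ e,
    Finset.mem_filter.2 ⟨hte, (Finset.mem_filter.1 htd).2⟩⟩

/-- A college `c` with capacity `q c = 1` cannot beneficially
manipulate the college-optimal stable mechanism: for every complete strict misreport
`P`, the student matched to `c` under the manipulated college-optimal stable matching
is not strictly preferred by `c`'s true order to the student matched to `c` under the
truthful one (being matched beats being unmatched). -/
theorem stmt_11 {S C : Type*} [Fintype S] [Fintype C] [DecidableEq C]
    (M : Market S C) (c : C) (hq : M.q c = 1)
    (P : LinearOrder S)
    (μ : Matching M) (μ' : Matching (replaceCPref M c P))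
    (hμ : CollegeOptimal M μ) (hμ' : CollegeOptimal (replaceCPref M c P) μ') :
    ¬ ∃ s', s' ∈ μ'.assign c ∧
        ((∀ s, s ∉ μ.assign c) ∨ ∃ s, s ∈ μ.assign c ∧ M.cprefers c s' s) := by
  rintro ⟨s', hs', hbetter⟩
  have hsingle (ρ : Matching M) {s t} (hs : s ∈ ρ.assign c) (ht : t ∈ ρ.assign c) : s = t :=
    Finset.card_le_one.1 (hq ▸ ρ.card_le c) s hs t ht
  let _ := M.cPref c
  obtain ⟨ρ, hρA, hρ⟩ := exists_stableOn M (fun d => {t | d = c → s' ≤ t})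
  rcases (ρ.assign c).eq_empty_or_nonempty with he | ⟨t, ht⟩
  · let ν : Matching M := ⟨μ'.assign, μ'.card_le, μ'.disjoint⟩
    have hρ' : StableOn M (fun d => {t | d = c → t = s'}) ρ := by
      refine ⟨fun d t htd => ?_, fun d t htd => hρ d t fun hd => (htd hd).ge⟩
      rintro rfl
      simp [he] at htd
    have hν : StableOn M (fun d => {t | d = c → t = s'}) ν := by
      refine ⟨fun d t htd => ?_, fun d t htd hb => ?_⟩
      · rintro rfl
        exact hsingle ν htd hs'
      · by_cases hd : d = c
        · obtain rfl := htd hd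
          subst hd
          let _ := M.sPref t
          exact lt_irrefl d (hb.1 d hs')
        · refine hμ'.1 t d ⟨hb.1, ?_⟩
          have hpref : (replaceCPref M c P).cPref d = M.cPref d := Function.update_of_ne hd _ _
          refine hb.2.imp_right fun ⟨x, hx, hlt⟩ => ⟨x, hx, ?_⟩
          rw [Market.cprefers, hpref]
          exact hlt
    exact Finset.notMem_empty s' (hρ'.assign_eq_empty hν he ▸ hs')
  · have hst : s' ≤ t := hρA c t ht rfl
    have hstable : Stable M ρ := by
      intro u d hb
      refine hρ d u ?_ hb
      rintro rfl
      rcases hb.2 with hlt | ⟨x, hx, hxu⟩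
      · rw [hq, Nat.lt_one_iff, Finset.card_eq_zero] at hlt
        simp [hlt] at ht
      · exact (hρA d x hx rfl).trans (le_of_lt hxu)
    obtain ⟨g, -, hgmem, hgle⟩ := hμ.2 ρ hstable c
    have hle : s' ≤ g t := by
      rcases hgle t ht with h | h
      · exact hst.trans h.ge
      · exact hst.trans (le_of_lt h)
    rcases hbetter with hempty | ⟨s, hs, hlt⟩
    · exact hempty _ (hgmem t ht)
    · exact absurd hlt (not_lt.2 (hsingle μ hs (hgmem t ht) ▸ hle))
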